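/- arXiv:2510.09834 — 4 statements merged into one kernel-verified Lean document; each statement's English description precedes it below -/
import Mathlib

section
/- Let ρ and σ be density matrices on ℂ^d with σ positive definite. Then the sandwiched Rényi divergence converges to the quantum relative entropy at order one: lim_{α → 1, α ≠ 1} D̃_α(ρ‖σ) = D(ρ‖σ). In particular lim_{α→0⁺} D̃_{1−α}(ρ‖σ) = D(ρ‖σ) and lim_{α→0⁺} D̃_{1+α}(ρ‖σ) = D(ρ‖σ). -/
open Matrix BigOperators
open scoped ComplexOrder

noncomputable section

variable {n : Type*} [Fintype n] [DecidableEq n]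

/-- Real power with the convention `0 ^ r = 0`. -/
def rpow0 (x r : ℝ) : ℝ := if x = 0 then 0 else Real.rpow x r

/-- Matrix power by the spectral functional calculus (with `0 ^ r = 0` on the kernel),
for Hermitian matrices; junk value `0` otherwise. -/
def matPow (M : Matrix n n ℂ) (r : ℝ) : Matrix n n ℂ :=
  if h : M.IsHermitian then
    (h.eigenvectorUnitary : Matrix n n ℂ) *
      Matrix.diagonal (fun i => (rpow0 (h.eigenvalues i) r : ℂ)) *
      star (h.eigenvectorUnitary : Matrix n n ℂ)
  else 0

/-- A density matrix: positive semidefinite with unit trace. -/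
def IsDensityMatrix (M : Matrix n n ℂ) : Prop := M.PosSemidef ∧ M.trace = 1

/-- Number of distinct eigenvalues of a Hermitian matrix (junk value `0` otherwise). -/
def nEig (M : Matrix n n ℂ) : ℕ :=
  if h : M.IsHermitian then (Finset.univ.image h.eigenvalues).card else 0

/-- The spectral projection of a Hermitian matrix onto the eigenspace of `t`. -/
def spectralProj (M : Matrix n n ℂ) (h : M.IsHermitian) (t : ℝ) : Matrix n n ℂ :=
  (h.eigenvectorUnitary : Matrix n n ℂ) *
    Matrix.diagonal (fun i => if h.eigenvalues i = t then (1 : ℂ) else 0) *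
    star (h.eigenvectorUnitary : Matrix n n ℂ)

/-- The pinching map with respect to a Hermitian matrix `A`:
`ℰ_A(B) = ∑_λ P_λ B P_λ` over the distinct eigenvalues `λ` of `A`. -/
def pinch (A B : Matrix n n ℂ) : Matrix n n ℂ :=
  if h : A.IsHermitian then
    ∑ t ∈ Finset.univ.image h.eigenvalues,
      spectralProj A h t * B * spectralProj A h t
  else B

/-- The spectral projection of a Hermitian matrix onto its nonnegative eigenvalues,
`Π = ∑_{λ ≥ 0} P_λ` (junk value `0` for non-Hermitian matrices). -/
def posProj (M : Matrix n n ℂ) : Matrix n n ℂ :=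
  if h : M.IsHermitian then
    (h.eigenvectorUnitary : Matrix n n ℂ) *
      Matrix.diagonal (fun i => if 0 ≤ h.eigenvalues i then (1 : ℂ) else 0) *
      star (h.eigenvectorUnitary : Matrix n n ℂ)
  else 0

/-- The sandwiched Rényi divergence
`D̃_α(ρ‖σ) = (1/(α−1)) log₂ Tr[(σ^{(1−α)/(2α)} ρ σ^{(1−α)/(2α)})^α]`. -/
def sandwichedRenyi (α : ℝ) (ρ σ : Matrix n n ℂ) : ℝ :=
  (1 / (α - 1)) *
    Real.logb 2
      ((matPow (matPow σ ((1 - α) / (2 * α)) * ρ * matPow σ ((1 - α) / (2 * α))) α).trace.re)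

/-- Fidelity `F(ρ,σ) = Tr[(σ^{1/2} ρ σ^{1/2})^{1/2}]`. -/
def fidelity (ρ σ : Matrix n n ℂ) : ℝ :=
  (matPow (matPow σ (1/2) * ρ * matPow σ (1/2)) (1/2)).trace.re

/-- Purified distance `P(ρ,σ) = √(1 − F(ρ,σ)²)`. -/
def purifiedDist (ρ σ : Matrix n n ℂ) : ℝ :=
  Real.sqrt (1 - (fidelity ρ σ) ^ 2)

/-- Base-two matrix logarithm by spectral functional calculus (`0 ↦ 0` on the kernel). -/
def matLog2 (M : Matrix n n ℂ) : Matrix n n ℂ :=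
  if h : M.IsHermitian then
    (h.eigenvectorUnitary : Matrix n n ℂ) *
      Matrix.diagonal (fun i => (Real.logb 2 (h.eigenvalues i) : ℂ)) *
      star (h.eigenvectorUnitary : Matrix n n ℂ)
  else 0

/-- Quantum relative entropy `D(ρ‖σ) = Tr[ρ (log₂ ρ − log₂ σ)]`. -/
def relEntropy (ρ σ : Matrix n n ℂ) : ℝ :=
  (ρ * (matLog2 ρ - matLog2 σ)).trace.re


end

open Filter Topology

section Scalar

/-- Second-order bound for the exponential. -/
lemma abs_exp_sub_one_sub_le (u : ℝ) :
    |Real.exp u - 1 - u| ≤ u ^ 2 * (Real.exp u + Real.exp (-u)) := by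
  have h1 := Real.add_one_le_exp u
  have h2 := Real.add_one_le_exp (-u)
  have h3 : Real.exp u * Real.exp (-u) = 1 := by rw [← Real.exp_add]; simp
  have hp := Real.exp_pos u
  have hm := Real.exp_pos (-u)
  rw [abs_of_nonneg (by linarith)]
  rcases le_total 0 u with hu | hu
  · have h4 : Real.exp u - 1 ≤ u * Real.exp u := by nlinarith
    have h5 : u * (Real.exp u - 1) ≤ u * (u * Real.exp u) := mul_le_mul_of_nonneg_left h4 hu
    have h6 : 0 ≤ u ^ 2 * Real.exp (-u) := by positivity
    nlinarith
  · have h4 : Real.exp u - 1 ≤ u * Real.exp u := by nlinarith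
    have h5 : u * (Real.exp u - 1) ≤ u * u := mul_le_mul_of_nonpos_left (by linarith) hu
    have h6 : 1 ≤ Real.exp (-u) := by linarith
    have h7 : u ^ 2 * 1 ≤ u ^ 2 * Real.exp (-u) := mul_le_mul_of_nonneg_left h6 (sq_nonneg u)
    have h8 : 0 ≤ u ^ 2 * Real.exp u := by positivity
    nlinarith

lemma continuousOn_rpow_half_mul_log_sq :
    ContinuousOn (fun x : ℝ => x ^ (1 / 2 : ℝ) * Real.log x ^ 2) (Set.Ici 0) := by
  have h : Continuous fun x : ℝ =>
      16 * (x ^ (1 / 4 : ℝ) * Real.log (x ^ (1 / 4 : ℝ))) ^ 2 := by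
    have h4 : Continuous fun x : ℝ => x ^ (1 / 4 : ℝ) :=
      Real.continuous_rpow_const (by norm_num)
    exact continuous_const.mul ((Real.continuous_mul_log.comp h4).pow 2)
  refine h.continuousOn.congr fun x hx => ?_
  rcases eq_or_lt_of_le (Set.mem_Ici.mp hx) with rfl | hx
  · simp
  · have h2 : x ^ (1 / 2 : ℝ) = (x ^ (1 / 4 : ℝ)) ^ 2 := by
      rw [← Real.rpow_natCast, ← Real.rpow_mul hx.le]; norm_num
    simp only [Real.log_rpow hx, h2]
    ring

/-- On a bounded interval, the difference quotient of `α ↦ x ^ α` at `1` approximates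
`x * log x` with an error that is linear in `α - 1`, uniformly in `x`. -/
lemma exists_rpow0_sub_le (b : ℝ) :
    ∃ C : ℝ, ∀ α : ℝ, |α - 1| ≤ 1 / 2 → ∀ x ∈ Set.Icc 0 b,
      |rpow0 x α - x - (α - 1) * (x * Real.log x)| ≤ C * (α - 1) ^ 2 := by
  have hcont : ContinuousOn
      (fun x : ℝ => (x + 1) * (x ^ (1 / 2 : ℝ) * Real.log x ^ 2)) (Set.Icc 0 b) :=
    (continuous_id.add continuous_const).continuousOn.mul
      (continuousOn_rpow_half_mul_log_sq.mono Set.Icc_subset_Ici_self)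
  obtain ⟨C, hC⟩ := isCompact_Icc.exists_bound_of_continuousOn hcont
  refine ⟨2 * C, fun α hα x hx => ?_⟩
  have hCx := (le_abs_self _).trans (hC x hx)
  rcases eq_or_lt_of_le hx.1 with rfl | hx0
  · have : 0 ≤ C := by simpa using hCx
    simp only [rpow0, if_true]
    simp
    positivity
  set t := α - 1 with ht
  set u := t * Real.log x with hu
  have hpow : rpow0 x α = x * Real.exp u := by
    have h : α = 1 + t := by rw [ht]; ring
    rw [rpow0, if_neg hx0.ne', Real.rpow_eq_pow, h, Real.rpow_add hx0, Real.rpow_one,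
      Real.rpow_def_of_pos hx0, mul_comm (Real.log x)]
  have hexp : ∀ s : ℝ, |s| ≤ 1 / 2 →
      x * Real.exp (s * Real.log x) ≤ (x + 1) * x ^ (1 / 2 : ℝ) := by
    intro s hs
    have hs' := abs_le.mp hs
    have hroot : x ^ (1 / 2 : ℝ) * x ^ (1 / 2 : ℝ) = x := by
      rw [← Real.rpow_add hx0]; norm_num
    have hrpos : 0 < x ^ (1 / 2 : ℝ) := Real.rpow_pos_of_pos hx0 _
    have h1 : x * Real.exp (s * Real.log x) = x ^ (1 + s) := by
      rw [Real.rpow_add hx0, Real.rpow_one, Real.rpow_def_of_pos hx0, mul_comm (Real.log x)]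
    rw [h1]
    rcases le_total x 1 with hx1 | hx1
    · calc x ^ (1 + s) ≤ x ^ (1 / 2 : ℝ) :=
            Real.rpow_le_rpow_of_exponent_ge hx0 hx1 (by linarith)
        _ ≤ (x + 1) * x ^ (1 / 2 : ℝ) := by nlinarith
    · calc x ^ (1 + s) ≤ x ^ (1 + 1 / 2 : ℝ) :=
            Real.rpow_le_rpow_of_exponent_le hx1 (by linarith)
        _ = x * x ^ (1 / 2 : ℝ) := by rw [Real.rpow_add hx0, Real.rpow_one]
        _ ≤ (x + 1) * x ^ (1 / 2 : ℝ) := by nlinarith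
  have hp := hexp t hα
  have hm := hexp (-t) (by rwa [abs_neg])
  rw [neg_mul] at hm
  have heq : rpow0 x α - x - t * (x * Real.log x) = x * (Real.exp u - 1 - u) := by
    rw [hpow, hu]; ring
  rw [heq, abs_mul, abs_of_pos hx0]
  calc x * |Real.exp u - 1 - u|
      ≤ x * (u ^ 2 * (Real.exp u + Real.exp (-u))) :=
        mul_le_mul_of_nonneg_left (abs_exp_sub_one_sub_le u) hx0.le
    _ = u ^ 2 * (x * Real.exp u + x * Real.exp (-u)) := by ring
    _ ≤ u ^ 2 * ((x + 1) * x ^ (1 / 2 : ℝ) + (x + 1) * x ^ (1 / 2 : ℝ)) :=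
        mul_le_mul_of_nonneg_left (add_le_add hp hm) (sq_nonneg u)
    _ = 2 * t ^ 2 * ((x + 1) * (x ^ (1 / 2 : ℝ) * Real.log x ^ 2)) := by rw [hu]; ring
    _ ≤ 2 * t ^ 2 * C := mul_le_mul_of_nonneg_left hCx (by positivity)
    _ = 2 * C * t ^ 2 := by ring

end Scalar

section SpectralCalculus

variable {n : Type*} [Fintype n] [DecidableEq n]

lemma matPow_eq_cfc {M : Matrix n n ℂ} (hM : M.IsHermitian) (r : ℝ) :
    matPow M r = cfc (fun x => rpow0 x r) M := by
  rw [hM.cfc_eq, matPow, dif_pos hM]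
  rfl

lemma matLog2_eq_cfc {M : Matrix n n ℂ} (hM : M.IsHermitian) :
    matLog2 M = cfc (Real.logb 2) M := by
  rw [hM.cfc_eq, matLog2, dif_pos hM]
  rfl

lemma continuousOn_real_spectrum (f : ℝ → ℝ) (M : Matrix n n ℂ) :
    ContinuousOn f (spectrum ℝ M) :=
  (Matrix.finite_real_spectrum (A := M)).continuousOn f

lemma trace_mul_cfc {M : Matrix n n ℂ} (hM : M.IsHermitian) (B : Matrix n n ℂ) (f : ℝ → ℝ) :
    (B * cfc f M).trace.re =
      ∑ i, ((star (hM.eigenvectorUnitary : Matrix n n ℂ) * B *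
        (hM.eigenvectorUnitary : Matrix n n ℂ)) i i).re * f (hM.eigenvalues i) := by
  rw [hM.cfc_eq, Matrix.IsHermitian.cfc, Unitary.conjStarAlgAut_apply, ← mul_assoc,
    Matrix.trace_mul_comm, ← mul_assoc, ← mul_assoc, Matrix.trace, Complex.re_sum]
  simp [Matrix.mul_diagonal]

lemma trace_cfc {M : Matrix n n ℂ} (hM : M.IsHermitian) (f : ℝ → ℝ) :
    (cfc f M).trace.re = ∑ i, f (hM.eigenvalues i) := by
  rw [← one_mul (cfc f M), trace_mul_cfc hM]
  simp

lemma matPow_mul_matPow {M : Matrix n n ℂ} (hM : M.PosDef) (r s : ℝ) :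
    matPow M r * matPow M s = matPow M (r + s) := by
  simp only [matPow_eq_cfc hM.1]
  rw [← cfc_mul _ _ M (continuousOn_real_spectrum _ M) (continuousOn_real_spectrum _ M)]
  refine cfc_congr fun x hx => ?_
  rw [hM.1.spectrum_real_eq_range_eigenvalues] at hx
  obtain ⟨i, rfl⟩ := hx
  have h := hM.eigenvalues_pos i
  simp only [rpow0, if_neg h.ne', Real.rpow_eq_pow, Real.rpow_add h]

lemma matPow_zero {M : Matrix n n ℂ} (hM : M.PosDef) : matPow M 0 = 1 := by
  rw [matPow_eq_cfc hM.1, ← cfc_one ℝ M hM.1.isSelfAdjoint]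
  refine cfc_congr fun x hx => ?_
  rw [hM.1.spectrum_real_eq_range_eigenvalues] at hx
  obtain ⟨i, rfl⟩ := hx
  have h := hM.eigenvalues_pos i
  simp [rpow0, h.ne']

lemma isHermitian_matPow {M : Matrix n n ℂ} (hM : M.IsHermitian) (r : ℝ) :
    (matPow M r).IsHermitian := by
  rw [matPow_eq_cfc hM]
  exact IsSelfAdjoint.cfc

lemma continuous_matPow {M : Matrix n n ℂ} (hM : M.PosDef) : Continuous (matPow M) := by
  have h : matPow M = fun r : ℝ => (hM.1.eigenvectorUnitary : Matrix n n ℂ) *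
      Matrix.diagonal (fun i => (rpow0 (hM.1.eigenvalues i) r : ℂ)) *
      star (hM.1.eigenvectorUnitary : Matrix n n ℂ) := by
    funext r
    rw [matPow, dif_pos hM.1]
  have hd : ∀ i, Continuous fun r : ℝ => (rpow0 (hM.1.eigenvalues i) r : ℂ) := by
    intro i
    have hi := hM.eigenvalues_pos i
    simp only [rpow0, if_neg hi.ne', Real.rpow_eq_pow]
    exact Complex.continuous_ofReal.comp (Real.continuous_const_rpow hi.ne')
  rw [h]
  exact (continuous_const.matrix_mul (continuous_pi hd).matrix_diagonal).matrix_mul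
    continuous_const

lemma spectrum_subset_Icc_trace {M : Matrix n n ℂ} (hM : M.PosSemidef) :
    spectrum ℝ M ⊆ Set.Icc 0 M.trace.re := by
  rw [hM.1.spectrum_real_eq_range_eigenvalues]
  rintro _ ⟨i, rfl⟩
  refine ⟨hM.eigenvalues_nonneg i, ?_⟩
  have htr : M.trace.re = ∑ j, hM.1.eigenvalues j := by
    rw [hM.1.trace_eq_sum_eigenvalues]; simp
  rw [htr]
  exact Finset.single_le_sum (fun j _ => hM.eigenvalues_nonneg j) (Finset.mem_univ i)

end SpectralCalculus

section Limit

open scoped Matrix.Norms.L2Operator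

variable {n : Type*} [Fintype n] [DecidableEq n]

/-- The operator `σ^{(1−α)/(2α)} ρ σ^{(1−α)/(2α)}`. -/
noncomputable def sandwich (ρ σ : Matrix n n ℂ) (α : ℝ) : Matrix n n ℂ :=
  matPow σ ((1 - α) / (2 * α)) * ρ * matPow σ ((1 - α) / (2 * α))

variable {ρ σ : Matrix n n ℂ}

lemma posSemidef_sandwich (hρ : ρ.PosSemidef) (hσ : σ.PosDef) (α : ℝ) :
    (sandwich ρ σ α).PosSemidef := by
  have h := hρ.mul_mul_conjTranspose_same (matPow σ ((1 - α) / (2 * α)))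
  rwa [(isHermitian_matPow hσ.1 _).eq] at h

lemma sandwich_one (hσ : σ.PosDef) : sandwich ρ σ 1 = ρ := by
  simp [sandwich, matPow_zero hσ]

lemma continuousAt_sandwich (hσ : σ.PosDef) : ContinuousAt (sandwich ρ σ) 1 := by
  have he : ContinuousAt (fun α : ℝ => (1 - α) / (2 * α)) 1 :=
    ContinuousAt.div (by fun_prop) (by fun_prop) (by norm_num)
  have hS : ContinuousAt (fun α : ℝ => matPow σ ((1 - α) / (2 * α))) 1 :=
    (continuous_matPow hσ).continuousAt.comp he
  exact (hS.mul continuousAt_const).mul hS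

lemma hasDerivAt_trace_sandwich (hσ : σ.PosDef) :
    HasDerivAt (fun α => (sandwich ρ σ α).trace.re)
      (-(ρ * cfc Real.log σ).trace.re) 1 := by
  have htr : ∀ α : ℝ, (sandwich ρ σ α).trace.re =
      (ρ * matPow σ ((1 - α) / (2 * α) + (1 - α) / (2 * α))).trace.re := by
    intro α
    rw [sandwich, Matrix.mul_assoc, Matrix.trace_mul_comm, Matrix.mul_assoc,
      matPow_mul_matPow hσ]
  simp only [htr, matPow_eq_cfc hσ.1, trace_mul_cfc hσ.1]
  rw [← Finset.sum_neg_distrib]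
  refine HasDerivAt.fun_sum fun i _ => ?_
  have hi := hσ.eigenvalues_pos i
  have he : HasDerivAt (fun α : ℝ => (1 - α) / (2 * α) + (1 - α) / (2 * α)) (-1) 1 := by
    have h : HasDerivAt (fun α : ℝ => (1 - α) / (2 * α)) (-1 / 2) 1 := by
      have hnum : HasDerivAt (fun α : ℝ => 1 - α) (-1) 1 := (hasDerivAt_id 1).const_sub 1
      have hden : HasDerivAt (fun α : ℝ => 2 * α) (2 * 1) 1 := (hasDerivAt_id 1).const_mul 2
      exact (hnum.div hden (by norm_num)).congr_deriv (by norm_num)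
    exact (h.add h).congr_deriv (by norm_num)
  simp only [rpow0, if_neg hi.ne', Real.rpow_eq_pow]
  exact ((he.const_rpow hi).const_mul _).congr_deriv (by norm_num)

lemma eventually_trace_sandwich_le (hσ : σ.PosDef) (htr : ρ.trace = 1) :
    ∀ᶠ α in 𝓝 (1 : ℝ), (sandwich ρ σ α).trace.re ≤ 2 := by
  have h := (hasDerivAt_trace_sandwich (ρ := ρ) hσ).continuousAt
  refine (h.eventually_lt continuousAt_const ?_).mono fun _ => le_of_lt
  simp [sandwich_one hσ, htr]

lemma tendsto_trace_mul_log_sandwich (hρ : ρ.PosSemidef) (htr : ρ.trace = 1) (hσ : σ.PosDef) :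
    Tendsto (fun α => (cfc (fun x => x * Real.log x) (sandwich ρ σ α)).trace.re) (𝓝 1)
      (𝓝 (cfc (fun x => x * Real.log x) ρ).trace.re) := by
  have hspec : ∀ᶠ α in 𝓝 (1 : ℝ), spectrum ℝ (sandwich ρ σ α) ⊆ Set.Icc 0 2 := by
    filter_upwards [eventually_trace_sandwich_le hσ htr] with α hα
    exact (spectrum_subset_Icc_trace (posSemidef_sandwich hρ hσ α)).trans
      (Set.Icc_subset_Icc_right hα)
  have hcfc := ContinuousAt.cfc isCompact_Icc (fun x => x * Real.log x)
    (continuousAt_sandwich (ρ := ρ) hσ) hspec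
    (.of_forall fun α => (posSemidef_sandwich hρ hσ α).1.isSelfAdjoint)
    Real.continuous_mul_log.continuousOn
  have hre : Continuous fun M : Matrix n n ℂ => M.trace.re :=
    Complex.continuous_re.comp continuous_id.matrix_trace
  have h := hre.continuousAt.comp hcfc
  simpa [ContinuousAt, Function.comp_def, sandwich_one hσ] using h

lemma trace_matPow_sandwich_one (hρ : ρ.PosSemidef) (htr : ρ.trace = 1) (hσ : σ.PosDef) :
    (matPow (sandwich ρ σ 1) 1).trace.re = 1 := by
  have hid : (fun x => rpow0 x 1) = (id : ℝ → ℝ) := by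
    funext x
    by_cases hx : x = 0 <;> simp [rpow0, hx]
  rw [sandwich_one hσ, matPow_eq_cfc hρ.1, hid, cfc_id ℝ ρ hρ.1.isSelfAdjoint, htr,
    Complex.one_re]

lemma hasDerivAt_trace_matPow_sandwich (hρ : ρ.PosSemidef) (htr : ρ.trace = 1)
    (hσ : σ.PosDef) :
    HasDerivAt (fun α => (matPow (sandwich ρ σ α) α).trace.re)
      ((cfc (fun x => x * Real.log x) ρ).trace.re - (ρ * cfc Real.log σ).trace.re) 1 := by
  obtain ⟨C, hC⟩ := exists_rpow0_sub_le 2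
  set X := sandwich ρ σ with hX
  have hXpos : ∀ α, (X α).PosSemidef := posSemidef_sandwich hρ hσ
  set E : ℝ → ℝ := fun α => (matPow (X α) α).trace.re - (X α).trace.re -
    (α - 1) * (cfc (fun x => x * Real.log x) (X α)).trace.re with hE
  have hEbound : ∀ᶠ α in 𝓝 (1 : ℝ), |E α| ≤ Fintype.card n * C * (α - 1) ^ 2 := by
    have hnear : ∀ᶠ α in 𝓝 (1 : ℝ), |α - 1| ≤ 1 / 2 := by
      filter_upwards [Metric.closedBall_mem_nhds (1 : ℝ) (by norm_num : (0 : ℝ) < 1 / 2)]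
        with α hα
      simpa [Real.dist_eq] using hα
    filter_upwards [hnear, eventually_trace_sandwich_le hσ htr] with α hα hα2
    have hHerm := (hXpos α).1
    have hsum : E α = ∑ i, (rpow0 (hHerm.eigenvalues i) α - hHerm.eigenvalues i -
        (α - 1) * (hHerm.eigenvalues i * Real.log (hHerm.eigenvalues i))) := by
      have htrace : (X α).trace.re = ∑ i, hHerm.eigenvalues i := by
        rw [hHerm.trace_eq_sum_eigenvalues]; simp
      simp only [hE, matPow_eq_cfc hHerm, trace_cfc hHerm, htrace, Finset.sum_sub_distrib,
        Finset.mul_sum]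
    rw [hsum]
    refine (Finset.abs_sum_le_sum_abs _ _).trans ?_
    have hle : ∀ i ∈ Finset.univ, |rpow0 (hHerm.eigenvalues i) α - hHerm.eigenvalues i -
        (α - 1) * (hHerm.eigenvalues i * Real.log (hHerm.eigenvalues i))| ≤
          C * (α - 1) ^ 2 := fun i _ => by
      refine hC α hα _ (Set.Icc_subset_Icc_right hα2 (spectrum_subset_Icc_trace (hXpos α) ?_))
      exact hHerm.eigenvalues_mem_spectrum_real i
    refine (Finset.sum_le_card_nsmul _ _ _ hle).trans_eq ?_
    rw [Finset.card_univ, nsmul_eq_mul, mul_assoc]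
  have hE1 : E 1 = 0 := by
    simp only [hE, hX, trace_matPow_sandwich_one hρ htr hσ]
    simp [sandwich_one hσ, htr]
  have hEderiv : HasDerivAt E 0 1 := by
    rw [hasDerivAt_iff_isLittleO]
    have hO : E =O[𝓝 1] fun α : ℝ => (α - 1) ^ 2 :=
      Asymptotics.IsBigO.of_bound (Fintype.card n * C) (by simpa using hEbound)
    have ho : (fun α : ℝ => (α - 1) ^ 2) =o[𝓝 1] fun α => α - 1 := by
      simpa using Asymptotics.isLittleO_pow_sub_sub (1 : ℝ) one_lt_two
    simpa [hE1] using hO.trans_isLittleO ho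
  have hent : HasDerivAt
      (fun α => (α - 1) * (cfc (fun x => x * Real.log x) (X α)).trace.re)
      (cfc (fun x => x * Real.log x) ρ).trace.re 1 := by
    rw [hasDerivAt_iff_tendsto_slope]
    refine ((tendsto_trace_mul_log_sandwich hρ htr hσ).mono_left nhdsWithin_le_nhds).congr' ?_
    filter_upwards [self_mem_nhdsWithin] with α hα
    have : α - 1 ≠ 0 := sub_ne_zero.mpr hα
    simp [slope_def_field, hX, this]
  have hall := (hEderiv.add hent).add (hasDerivAt_trace_sandwich (ρ := ρ) hσ)
  refine (hall.congr_deriv (by ring)).congr_of_eventuallyEq (.of_forall fun α => ?_)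
  simp only [hE, Pi.add_apply, hX]
  ring

lemma relEntropy_eq_div_log_two (hρ : ρ.IsHermitian) (hσ : σ.IsHermitian) :
    relEntropy ρ σ =
      ((cfc (fun x => x * Real.log x) ρ).trace.re - (ρ * cfc Real.log σ).trace.re) /
        Real.log 2 := by
  have hmul : ρ * cfc (Real.logb 2) ρ = cfc (fun x => x * Real.logb 2 x) ρ := by
    conv_lhs => enter [1]; rw [← cfc_id' ℝ ρ hρ.isSelfAdjoint]
    rw [← cfc_mul _ _ ρ (continuousOn_real_spectrum _ ρ) (continuousOn_real_spectrum _ ρ)]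
  rw [relEntropy, mul_sub, Matrix.trace_sub, Complex.sub_re, matLog2_eq_cfc hρ,
    matLog2_eq_cfc hσ, hmul, trace_cfc hρ, trace_cfc hρ, trace_mul_cfc hσ, trace_mul_cfc hσ]
  simp only [Real.logb, sub_div, Finset.sum_div, mul_div_assoc]

lemma tendsto_sandwichedRenyi (hρ : ρ.PosSemidef) (htr : ρ.trace = 1) (hσ : σ.PosDef) :
    Tendsto (fun α : ℝ => sandwichedRenyi α ρ σ) (𝓝[≠] 1) (𝓝 (relEntropy ρ σ)) := by
  have h1 := trace_matPow_sandwich_one hρ htr hσ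
  have hlog := (hasDerivAt_trace_matPow_sandwich hρ htr hσ).log (by rw [h1]; exact one_ne_zero)
  have h := (hlog.div_const (Real.log 2)).tendsto_slope
  rw [h1, div_one, ← relEntropy_eq_div_log_two hρ.1 hσ.1] at h
  refine h.congr fun α => ?_
  rw [slope_def_field, h1, Real.log_one, zero_div, sub_zero, sandwichedRenyi, Real.logb,
    sandwich]
  ring

end Limit

/-- STATEMENT 8: the sandwiched Rényi divergence converges to the quantum relative
entropy at order one, together with the two one-sided limits
`lim_{α→0⁺} D̃_{1−α}(ρ‖σ) = D(ρ‖σ)` and `lim_{α→0⁺} D̃_{1+α}(ρ‖σ) = D(ρ‖σ)`. -/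
theorem sandwiched_renyi_tendsto_relEntropy
    {n : Type*} [Fintype n] [DecidableEq n]
    (ρ σ : Matrix n n ℂ) (hρ : IsDensityMatrix ρ) (hσ : IsDensityMatrix σ)
    (hσpd : σ.PosDef) :
    Tendsto (fun α : ℝ => sandwichedRenyi α ρ σ)
        (nhdsWithin 1 {(1 : ℝ)}ᶜ) (nhds (relEntropy ρ σ)) ∧
      Tendsto (fun α : ℝ => sandwichedRenyi (1 - α) ρ σ)
        (nhdsWithin 0 (Set.Ioi (0 : ℝ))) (nhds (relEntropy ρ σ)) ∧
      Tendsto (fun α : ℝ => sandwichedRenyi (1 + α) ρ σ)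
        (nhdsWithin 0 (Set.Ioi (0 : ℝ))) (nhds (relEntropy ρ σ)) := by
  have h := tendsto_sandwichedRenyi hρ.1 hρ.2 hσpd
  refine ⟨h, h.comp ?_, h.comp ?_⟩
  · refine tendsto_nhdsWithin_iff.mpr ⟨?_, ?_⟩
    · exact ((continuous_const.sub continuous_id).tendsto' (0 : ℝ) 1 (by simp)).mono_left
        nhdsWithin_le_nhds
    · filter_upwards [self_mem_nhdsWithin] with α hα
      have : (0 : ℝ) < α := hα
      simp [this.ne']
  · refine tendsto_nhdsWithin_iff.mpr ⟨?_, ?_⟩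
    · exact ((continuous_const.add continuous_id).tendsto' (0 : ℝ) 1 (by simp)).mono_left
        nhdsWithin_le_nhds
    · filter_upwards [self_mem_nhdsWithin] with α hα
      have : (0 : ℝ) < α := hα
      simp [this.ne']
end

section
/- Let ρ and σ be density matrices on ℂ^d with σ positive definite, and let α ∈ (0, 1/2). Then the squared purified distance satisfies 1 − F(ρ,σ)² ≤ (ln 2) · D̃_{1+α}(ρ‖σ); equivalently P(ρ,σ)² ≤ (ln 2) · D̃_{1+α}(ρ‖σ). -/
open Matrix BigOperators
open scoped ComplexOrder

section Scalar

variable {ι : Type*} [Fintype ι]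

/-- Hölder's inequality for weighted geometric means. -/
lemma sum_rpow_mul_rpow_le {a b : ι → ℝ} (ha : ∀ i, 0 ≤ a i) (hb : ∀ i, 0 ≤ b i)
    {x y : ℝ} (hx : 0 < x) (hy : 0 < y) (hxy : x + y = 1) :
    ∑ i, a i ^ x * b i ^ y ≤ (∑ i, a i) ^ x * (∑ i, b i) ^ y := by
  have hpq : Real.HolderConjugate x⁻¹ y⁻¹ := by
    rw [Real.holderConjugate_iff]
    refine ⟨(one_lt_inv₀ hx).2 (by linarith), by simpa using hxy⟩
  have h := Real.inner_le_Lp_mul_Lq_of_nonneg (s := Finset.univ) hpq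
    (fun i _ => Real.rpow_nonneg (ha i) x) (fun i _ => Real.rpow_nonneg (hb i) y)
  simpa [Real.rpow_rpow_inv (ha _) hx.ne', Real.rpow_rpow_inv (hb _) hy.ne'] using h

/-- The comparison of orders `1/2` and `1 + α` expressed through the overlap weights `w`. -/
lemma one_le_sum_rpow_mul_sum_rpow {w : ι → ι → ℝ} (hw : ∀ i j, 0 ≤ w i j)
    (hw1 : ∑ j, ∑ i, w i j = 1) {s t : ι → ℝ} (hs : ∀ i, 0 < s i) (ht : ∀ j, 0 ≤ t j)
    (hst : ∀ j, ∑ i, w i j * s i = t j ^ 2) {α : ℝ} (hα : 0 < α) :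
    1 ≤ (∑ j, t j) ^ (2 * α / (1 + 2 * α)) *
      (∑ j, (∑ i, w i j * s i ^ (-α / (1 + α))) ^ (1 + α)) ^ (1 / (1 + 2 * α)) := by
  have hy : ∀ j, 0 ≤ ∑ i, w i j * s i ^ (-α / (1 + α)) := fun j =>
    Finset.sum_nonneg fun i _ => mul_nonneg (hw i j) (Real.rpow_nonneg (hs i).le _)
  have h1 : 0 < 1 + α := by linarith
  have h2 : 0 < 1 + 2 * α := by linarith
  refine le_trans ?_ (sum_rpow_mul_rpow_le ht (fun j => Real.rpow_nonneg (hy j) (1 + α))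
    (by positivity) (by positivity) (by field_simp; ring))
  refine hw1.symm.trans_le (Finset.sum_le_sum fun j _ => ?_)
  have h := sum_rpow_mul_rpow_le (a := fun i => w i j * s i)
    (b := fun i => w i j * s i ^ (-α / (1 + α)))
    (fun i => mul_nonneg (hw i j) (hs i).le)
    (fun i => mul_nonneg (hw i j) (Real.rpow_nonneg (hs i).le _))
    (x := α / (1 + 2 * α)) (y := (1 + α) / (1 + 2 * α))
    (by positivity) (by positivity) (by field_simp; ring)
  rw [hst] at h
  refine le_trans (le_of_eq (Finset.sum_congr rfl fun i _ => ?_)) (h.trans (le_of_eq ?_))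
  · rw [Real.mul_rpow (hw i j) (hs i).le,
      Real.mul_rpow (hw i j) (Real.rpow_nonneg (hs i).le _), mul_mul_mul_comm,
      ← Real.rpow_add_of_nonneg (hw i j) (by positivity) (by positivity),
      ← Real.rpow_mul (hs i).le, ← Real.rpow_add (hs i)]
    have e1 : α / (1 + 2 * α) + (1 + α) / (1 + 2 * α) = 1 := by field_simp; ring
    have e2 : α / (1 + 2 * α) + -α / (1 + α) * ((1 + α) / (1 + 2 * α)) = 0 := by
      field_simp; ring
    rw [e1, e2]; simp
  · rw [← Real.rpow_natCast, ← Real.rpow_mul (ht j), ← Real.rpow_mul (hy j)]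
    congr 2 <;> push_cast <;> field_simp

/-- The classical Rényi divergence of order `1 + α` is nonnegative. -/
lemma one_le_sum_rpow {r s : ι → ℝ} (hr : ∀ i, 0 ≤ r i) (hs : ∀ i, 0 < s i)
    (hr1 : ∑ i, r i = 1) (hs1 : ∑ i, s i = 1) {α : ℝ} (hα : 0 < α) :
    1 ≤ ∑ i, (r i * s i ^ (-α / (1 + α))) ^ (1 + α) := by
  have h1 : 0 < 1 + α := by linarith
  have hc : ∀ i, 0 ≤ r i * s i ^ (-α / (1 + α)) := fun i =>
    mul_nonneg (hr i) (Real.rpow_nonneg (hs i).le _)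
  have h := sum_rpow_mul_rpow_le
    (fun i => Real.rpow_nonneg (hc i) (1 + α)) (fun i => (hs i).le)
    (x := 1 / (1 + α)) (y := α / (1 + α)) (by positivity) (by positivity) (by field_simp)
  have e : ∑ i, ((r i * s i ^ (-α / (1 + α))) ^ (1 + α)) ^ (1 / (1 + α)) *
      s i ^ (α / (1 + α)) = 1 := by
    refine (Finset.sum_congr rfl fun i _ => ?_).trans hr1
    rw [one_div, Real.rpow_rpow_inv (hc i) h1.ne', mul_assoc, ← Real.rpow_add (hs i)]
    have : -α / (1 + α) + α / (1 + α) = 0 := by field_simp; ring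
    rw [this]; simp
  rw [e, hs1, Real.one_rpow, mul_one] at h
  by_contra! hlt
  exact absurd h (not_le.2 (Real.rpow_lt_one
    (Finset.sum_nonneg fun i _ => Real.rpow_nonneg (hc i) _) hlt (by positivity)))

end Scalar

section MatrixPowers

variable {n : Type*} [Fintype n] [DecidableEq n]

lemma rpow0_of_ne_zero (x : ℝ) {r : ℝ} (hr : r ≠ 0) : rpow0 x r = x ^ r := by
  unfold rpow0
  split_ifs with h
  · rw [h, Real.zero_rpow hr]
  · rfl

lemma matPow_trace_re {M : Matrix n n ℂ} (h : M.IsHermitian) (r : ℝ) :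
    (matPow M r).trace.re = ∑ i, rpow0 (h.eigenvalues i) r := by
  rw [matPow, dif_pos h, Matrix.trace_mul_comm, ← mul_assoc, Unitary.coe_star_mul_self, one_mul,
    Matrix.trace_diagonal]
  simp

lemma matPow_conjTranspose (M : Matrix n n ℂ) (r : ℝ) : (matPow M r)ᴴ = matPow M r := by
  unfold matPow
  split_ifs with h
  · simp only [Matrix.conjTranspose_mul, Matrix.star_eq_conjTranspose,
      Matrix.conjTranspose_conjTranspose, Matrix.diagonal_conjTranspose, mul_assoc]
    congr 3
    ext i
    simp
  · simp

/-- The trace of a power of a Gram matrix does not depend on the order of the factors. -/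
lemma matPow_trace_gram_comm (K : Matrix n n ℂ) (r : ℝ) :
    (matPow (Kᴴ * K) r).trace.re = (matPow (K * Kᴴ) r).trace.re := by
  have h1 := Matrix.isHermitian_conjTranspose_mul_self K
  have h2 := Matrix.isHermitian_mul_conjTranspose_self K
  rw [matPow_trace_re h1, matPow_trace_re h2,
    (h1.eigenvalues_eq_eigenvalues_iff h2).2 (Matrix.charpoly_mul_comm _ _)]

lemma conj_diagonal_apply_self (U C : Matrix n n ℂ) (d : n → ℝ) (j : n) :
    (Cᴴ * (U * Matrix.diagonal (fun i => (d i : ℂ)) * star U) * C) j j =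
      ((∑ i, Complex.normSq ((star U * C) i j) * d i : ℝ) : ℂ) := by
  have : Cᴴ * (U * Matrix.diagonal (fun i => (d i : ℂ)) * star U) * C =
      (star U * C)ᴴ * (Matrix.diagonal (fun i => (d i : ℂ)) * (star U * C)) := by
    simp [Matrix.star_eq_conjTranspose, mul_assoc]
  rw [this, Matrix.mul_apply]
  push_cast
  refine Finset.sum_congr rfl fun i _ => ?_
  rw [Matrix.diagonal_mul, Matrix.conjTranspose_apply, Complex.normSq_eq_conj_mul_self]
  simp only [RCLike.star_def]
  ring

lemma eq_eigenvectorUnitary_mul {M : Matrix n n ℂ} (h : M.IsHermitian) :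
    M = (h.eigenvectorUnitary : Matrix n n ℂ) *
      Matrix.diagonal (fun i => (h.eigenvalues i : ℂ)) *
      star (h.eigenvectorUnitary : Matrix n n ℂ) := by
  conv_lhs => rw [h.spectral_theorem, Unitary.conjStarAlgAut_apply]
  rfl

lemma sum_normSq_col (W : Matrix.unitaryGroup n ℂ) (j : n) :
    ∑ i, Complex.normSq ((W : Matrix n n ℂ) i j) = 1 := by
  have h := congrFun₂ (Unitary.coe_star_mul_self W) j j
  rw [Matrix.mul_apply, Matrix.one_apply_eq] at h
  simp only [Matrix.star_apply, RCLike.star_def, ← Complex.normSq_eq_conj_mul_self] at h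
  exact_mod_cast h

lemma sum_normSq_row (W : Matrix.unitaryGroup n ℂ) (i : n) :
    ∑ j, Complex.normSq ((W : Matrix n n ℂ) i j) = 1 := by
  simpa using sum_normSq_col (star W) i

/-- Peierls' inequality for the power function. -/
lemma sum_diag_rpow_le {M : Matrix n n ℂ} (hM : M.PosSemidef) (V : Matrix.unitaryGroup n ℂ)
    {β : ℝ} (hβ : 1 ≤ β) :
    ∑ j, (((V : Matrix n n ℂ)ᴴ * M * V) j j).re ^ β ≤ (matPow M β).trace.re := by
  have h := hM.isHermitian
  rw [matPow_trace_re h]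
  simp only [rpow0_of_ne_zero _ (by linarith : β ≠ 0)]
  set W : Matrix.unitaryGroup n ℂ := star h.eigenvectorUnitary * V
  have key : ∀ j, (((V : Matrix n n ℂ)ᴴ * M * V) j j).re =
      ∑ i, Complex.normSq ((W : Matrix n n ℂ) i j) * h.eigenvalues i := fun j => by
    conv_lhs => rw [eq_eigenvectorUnitary_mul h]
    rw [conj_diagonal_apply_self, Complex.ofReal_re]
    rfl
  calc ∑ j, (((V : Matrix n n ℂ)ᴴ * M * V) j j).re ^ β
      ≤ ∑ j, ∑ i, Complex.normSq ((W : Matrix n n ℂ) i j) * h.eigenvalues i ^ β := by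
        refine Finset.sum_le_sum fun j _ => ?_
        rw [key]
        exact Real.rpow_arith_mean_le_arith_mean_rpow _ _ _ (fun i _ => Complex.normSq_nonneg _)
          (sum_normSq_col W j) (fun i _ => hM.eigenvalues_nonneg i) hβ
    _ = ∑ i, h.eigenvalues i ^ β := by
        rw [Finset.sum_comm]
        simp only [← Finset.sum_mul, sum_normSq_row, one_mul]

lemma matPow_mul_self_of_posDef {σ : Matrix n n ℂ} (hσ : σ.PosDef) (r : ℝ) :
    matPow σ r * matPow σ r = (hσ.isHermitian.eigenvectorUnitary : Matrix n n ℂ) *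
      Matrix.diagonal (fun i => ((hσ.isHermitian.eigenvalues i ^ (2 * r) : ℝ) : ℂ)) *
      star (hσ.isHermitian.eigenvectorUnitary : Matrix n n ℂ) := by
  have h := hσ.isHermitian
  rw [matPow, dif_pos h]
  set U := h.eigenvectorUnitary
  calc _ = (U : Matrix n n ℂ) * (Matrix.diagonal (fun i => (rpow0 (h.eigenvalues i) r : ℂ)) *
        (star (U : Matrix n n ℂ) * U) *
        Matrix.diagonal (fun i => (rpow0 (h.eigenvalues i) r : ℂ))) * star (U : Matrix n n ℂ) := by
        simp only [mul_assoc]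
    _ = _ := by
        rw [Unitary.coe_star_mul_self, mul_one, Matrix.diagonal_mul_diagonal]
        congr 3
        ext i
        have hp := hσ.eigenvalues_pos i
        rw [rpow0, if_neg hp.ne', two_mul, Real.rpow_add hp]
        push_cast
        rfl

end MatrixPowers

section Divergence

variable {n : Type*} [Fintype n] [DecidableEq n]

/-- Diagonal entries of `σ ^ r * ρ * σ ^ r` in an eigenbasis of `σ`. -/
lemma eigenbasis_sandwich_apply_self {ρ σ : Matrix n n ℂ} (hσ : σ.PosDef) (r : ℝ) (i : n) :
    let U := (hσ.isHermitian.eigenvectorUnitary : Matrix n n ℂ)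
    ((Uᴴ * (matPow σ r * ρ * matPow σ r) * U) i i).re =
      ((Uᴴ * ρ * U) i i).re * hσ.isHermitian.eigenvalues i ^ (2 * r) := by
  intro U
  have hU : Uᴴ * U = 1 := Unitary.coe_star_mul_self hσ.isHermitian.eigenvectorUnitary
  have hp := hσ.eigenvalues_pos i
  set D := Matrix.diagonal (fun i => (rpow0 (hσ.isHermitian.eigenvalues i) r : ℂ)) with hD
  have hS : matPow σ r = U * D * Uᴴ := by
    rw [matPow, dif_pos hσ.isHermitian]; rfl
  have : Uᴴ * (matPow σ r * ρ * matPow σ r) * U = D * (Uᴴ * ρ * U) * D := by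
    calc _ = (Uᴴ * U) * D * (Uᴴ * ρ * U) * D * (Uᴴ * U) := by rw [hS]; simp only [mul_assoc]
      _ = _ := by rw [hU]; simp
  rw [this, hD, Matrix.mul_diagonal, Matrix.diagonal_mul, rpow0, if_neg hp.ne', two_mul,
    Real.rpow_add hp]
  simp only [Complex.re_mul_ofReal, Complex.re_ofReal_mul]
  change hσ.isHermitian.eigenvalues i ^ r * _ * hσ.isHermitian.eigenvalues i ^ r = _
  ring

lemma trace_conj_unitary (U : Matrix.unitaryGroup n ℂ) (M : Matrix n n ℂ) :
    ((U : Matrix n n ℂ)ᴴ * M * U).trace = M.trace := by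
  rw [Matrix.trace_mul_comm, ← mul_assoc]
  have : (U : Matrix n n ℂ) * (U : Matrix n n ℂ)ᴴ = 1 := Unitary.coe_mul_star_self U
  rw [this, one_mul]

/-- The trace functional in the sandwiched Rényi divergence of order `1 + α` is at least `1`. -/
lemma one_le_trace_sandwich {ρ σ : Matrix n n ℂ} (hρ : IsDensityMatrix ρ)
    (hσ : IsDensityMatrix σ) (hσpd : σ.PosDef) {α r : ℝ} (hα : 0 < α)
    (hr : 2 * r = -α / (1 + α)) :
    1 ≤ (matPow (matPow σ r * ρ * matPow σ r) (1 + α)).trace.re := by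
  have hM : (matPow σ r * ρ * matPow σ r).PosSemidef := by
    simpa [matPow_conjTranspose] using hρ.1.conjTranspose_mul_mul_same (matPow σ r)
  set U := hσpd.isHermitian.eigenvectorUnitary with hU
  refine le_trans ?_ (sum_diag_rpow_le hM U (by linarith))
  simp only [hU, eigenbasis_sandwich_apply_self hσpd, hr]
  refine one_le_sum_rpow (fun i => ?_) hσpd.eigenvalues_pos ?_ ?_ hα
  · have := (hρ.1.conjTranspose_mul_mul_same (U : Matrix n n ℂ)).diag_nonneg (i := i)
    exact (Complex.le_def.1 this).1
  · have := congrArg Complex.re ((trace_conj_unitary U ρ).trans hρ.2)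
    simpa [Matrix.trace] using this
  · have := congrArg Complex.re hσ.2
    rw [hσpd.isHermitian.trace_eq_sum_eigenvalues] at this
    simpa using this

/-- Comparison of the sandwiched Rényi divergences of orders `1/2` and `1 + α`. -/
lemma one_le_fidelity_rpow_mul {ρ σ : Matrix n n ℂ} (hρ : IsDensityMatrix ρ)
    (hσpd : σ.PosDef) {α r : ℝ} (hα : 0 < α) (hr : 2 * r = -α / (1 + α)) :
    0 ≤ fidelity ρ σ ∧ 1 ≤ fidelity ρ σ ^ (2 * α / (1 + 2 * α)) *
      (matPow (matPow σ r * ρ * matPow σ r) (1 + α)).trace.re ^ (1 / (1 + 2 * α)) := by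
  obtain ⟨L, rfl⟩ : ∃ L : Matrix n n ℂ, ρ = Lᴴ * L := by
    open scoped MatrixOrder in
    exact CStarAlgebra.nonneg_iff_eq_star_mul_self.1 hρ.1.nonneg
  have gram : ∀ q : ℝ, matPow σ q * (Lᴴ * L) * matPow σ q =
      (L * matPow σ q)ᴴ * (L * matPow σ q) := fun q => by
    simp [matPow_conjTranspose, mul_assoc]
  set s := hσpd.isHermitian.eigenvalues with hs
  set U := hσpd.isHermitian.eigenvectorUnitary with hU
  set N : Matrix n n ℂ := (L * matPow σ (1 / 2)) * (L * matPow σ (1 / 2))ᴴ with hN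
  have hNp : N.PosSemidef := Matrix.posSemidef_self_mul_conjTranspose _
  have hNh := hNp.isHermitian
  set V := hNh.eigenvectorUnitary with hV
  set w : n → n → ℝ := fun i j =>
    Complex.normSq ((star (U : Matrix n n ℂ) * (Lᴴ * (V : Matrix n n ℂ))) i j) with hw
  have diag : ∀ (q : ℝ) (j : n), (((V : Matrix n n ℂ)ᴴ *
      ((L * matPow σ q) * (L * matPow σ q)ᴴ) * V) j j).re = ∑ i, w i j * s i ^ (2 * q) := by
    intro q j
    rw [← Complex.ofReal_re (∑ i, w i j * s i ^ (2 * q)), ← conj_diagonal_apply_self,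
      ← matPow_mul_self_of_posDef hσpd]
    simp [matPow_conjTranspose, mul_assoc]
  set t : n → ℝ := fun j => hNh.eigenvalues j ^ (1 / 2 : ℝ) with htdef
  have ht : ∀ j, 0 ≤ t j := fun j => Real.rpow_nonneg (hNp.eigenvalues_nonneg j) _
  have hF : fidelity (Lᴴ * L) σ = ∑ j, t j := by
    rw [fidelity, gram, matPow_trace_gram_comm, matPow_trace_re hNh]
    simp only [rpow0_of_ne_zero _ (by norm_num : (1 / 2 : ℝ) ≠ 0), htdef]
  have hst : ∀ j, ∑ i, w i j * s i = t j ^ 2 := by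
    intro j
    have h := diag (1 / 2) j
    have e : (V : Matrix n n ℂ)ᴴ * N * V =
        Matrix.diagonal (fun i => (hNh.eigenvalues i : ℂ)) := by
      have hVV : (V : Matrix n n ℂ)ᴴ * V = 1 := Unitary.coe_star_mul_self V
      conv_lhs => rw [eq_eigenvectorUnitary_mul hNh]
      rw [Matrix.star_eq_conjTranspose, ← hV]
      calc _ = ((V : Matrix n n ℂ)ᴴ * V) * Matrix.diagonal (fun i => (hNh.eigenvalues i : ℂ)) *
            ((V : Matrix n n ℂ)ᴴ * V) := by simp only [mul_assoc]
        _ = _ := by rw [hVV]; simp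
    rw [← hN, e] at h
    simp only [Matrix.diagonal_apply_eq, Complex.ofReal_re] at h
    rw [htdef]
    simp only
    rw [← Real.rpow_natCast, ← Real.rpow_mul (hNp.eigenvalues_nonneg j)]
    norm_num
    rw [h]
    norm_num
  have hw1 : ∑ j, ∑ i, w i j = 1 := by
    have h : ∀ j, (((V : Matrix n n ℂ)ᴴ * (L * Lᴴ) * V) j j).re = ∑ i, w i j := by
      intro j
      have := conj_diagonal_apply_self (U : Matrix n n ℂ) (Lᴴ * V) (fun _ => 1) j
      simp only [mul_one, Complex.ofReal_one, Matrix.diagonal_one] at this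
      rw [show (U : Matrix n n ℂ) * star (U : Matrix n n ℂ) = 1 from
        Unitary.coe_mul_star_self U, mul_one] at this
      rw [← Complex.ofReal_re (∑ i, w i j), ← this]
      simp [mul_assoc]
    have h2 := congrArg Complex.re (trace_conj_unitary V (L * Lᴴ))
    rw [Matrix.trace_mul_comm L, hρ.2] at h2
    simp only [Matrix.trace, Matrix.diag_apply, Complex.re_sum, h, Complex.one_re] at h2
    exact h2
  refine ⟨hF ▸ Finset.sum_nonneg fun j _ => ht j, ?_⟩
  refine (one_le_sum_rpow_mul_sum_rpow (fun i j => Complex.normSq_nonneg _) hw1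
    hσpd.eigenvalues_pos ht hst hα).trans ?_
  rw [hF]
  refine mul_le_mul_of_nonneg_left (Real.rpow_le_rpow ?_ ?_ (by positivity))
    (Real.rpow_nonneg (Finset.sum_nonneg fun j _ => ht j) _)
  · exact Finset.sum_nonneg fun j _ => Real.rpow_nonneg (Finset.sum_nonneg fun i _ =>
      mul_nonneg (Complex.normSq_nonneg _) (Real.rpow_nonneg (hσpd.eigenvalues_pos i).le _)) _
  · rw [gram, matPow_trace_gram_comm]
    refine le_trans (le_of_eq ?_) (sum_diag_rpow_le
      (Matrix.posSemidef_self_mul_conjTranspose (L * matPow σ r)) V (by linarith))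
    simp only [diag, hr, hs, hw]

end Divergence

/-- STATEMENT 9: the squared purified distance is bounded by the sandwiched Rényi
divergence: `1 − F(ρ,σ)² ≤ (ln 2) · D̃_{1+α}(ρ‖σ)`, i.e. `P(ρ,σ)² ≤ (ln 2) · D̃_{1+α}(ρ‖σ)`. -/
theorem purified_distance_le_renyi
    {n : Type*} [Fintype n] [DecidableEq n]
    (ρ σ : Matrix n n ℂ) (hρ : IsDensityMatrix ρ) (hσ : IsDensityMatrix σ)
    (hσpd : σ.PosDef) (α : ℝ) (hα : α ∈ Set.Ioo (0 : ℝ) (1/2)) :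
    1 - fidelity ρ σ ^ 2 ≤ Real.log 2 * sandwichedRenyi (1 + α) ρ σ ∧
      purifiedDist ρ σ ^ 2 ≤ Real.log 2 * sandwichedRenyi (1 + α) ρ σ := by
  obtain ⟨hα0, -⟩ := hα
  have hr : 2 * ((1 - (1 + α)) / (2 * (1 + α))) = -α / (1 + α) := by
    have : 1 + α ≠ 0 := by linarith
    field_simp
    ring
  have hQ1 := one_le_trace_sandwich hρ hσ hσpd hα0 hr
  obtain ⟨hF0, hFQ⟩ := one_le_fidelity_rpow_mul hρ hσpd hα0 hr
  have hD : Real.log 2 * sandwichedRenyi (1 + α) ρ σ = Real.log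
      (matPow (matPow σ ((1 - (1 + α)) / (2 * (1 + α))) * ρ *
        matPow σ ((1 - (1 + α)) / (2 * (1 + α)))) (1 + α)).trace.re / α := by
    have := (Real.log_pos one_lt_two).ne'
    rw [sandwichedRenyi, Real.logb, add_sub_cancel_left]
    field_simp
  rw [hD]
  generalize (matPow (matPow σ ((1 - (1 + α)) / (2 * (1 + α))) * ρ *
        matPow σ ((1 - (1 + α)) / (2 * (1 + α)))) (1 + α)).trace.re = Q at hQ1 hFQ
  have h2 : 0 < 1 + 2 * α := by linarith
  have hF : 0 < fidelity ρ σ := by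
    refine lt_of_le_of_ne hF0 fun h => ?_
    rw [← h, Real.zero_rpow (by positivity), zero_mul] at hFQ
    linarith
  have hQ : 0 < Q := by linarith
  have hlog := Real.log_nonneg hFQ
  rw [Real.log_mul (Real.rpow_pos_of_pos hF _).ne' (Real.rpow_pos_of_pos hQ _).ne',
    Real.log_rpow hF, Real.log_rpow hQ] at hlog
  have hlog' : 0 ≤ 2 * α * Real.log (fidelity ρ σ) + Real.log Q := by
    have := mul_nonneg h2.le hlog
    field_simp at this
    linarith
  have hmain : 1 - fidelity ρ σ ^ 2 ≤ Real.log Q / α := by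
    have h := Real.log_le_sub_one_of_pos (pow_pos hF 2)
    rw [Real.log_pow] at h
    push_cast at h
    rw [le_div_iff₀ hα0]
    nlinarith
  refine ⟨hmain, ?_⟩
  rw [purifiedDist, Real.sq_sqrt']
  exact max_le hmain (div_nonneg (Real.log_nonneg hQ1) hα0.le)
end

section
/- Commuting core of the projector lemma: let {P_i}_{i∈I} be a finite family of d×d complex orthogonal projections (Hermitian, P_i² = P_i, P_i P_j = 0 for i ≠ j) with ∑_{i∈I} P_i = I. Let X = ∑_i x_i P_i and Y = ∑_i y_i P_i with all x_i, y_i ≥ 0, let c > 0, α ∈ (0,1], and set Π := ∑_{i : x_i ≥ c·y_i} P_i. Then both inequalities hold: Tr[(I − Π) X] ≤ c^α · Tr[X^{1−α} Y^α] and c · Tr[Π Y] ≤ c^α · Tr[X^{1−α} Y^α], where X^{1−α} Y^α = ∑_i x_i^{1−α} y_i^α P_i (with the convention 0^r = 0). -/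
open Matrix BigOperators
open scoped ComplexOrder

theorem le_rpow_mul_rpow0_of_lt {x y c α : ℝ} (hx : 0 ≤ x) (hc : 0 < c) (hα : 0 ≤ α)
    (h : x < c * y) : x ≤ c ^ α * (rpow0 x (1 - α) * rpow0 y α) := by
  have hy : 0 < y := pos_of_mul_pos_right (hx.trans_lt h) hc.le
  rcases hx.eq_or_lt with rfl | hx
  · simp [rpow0]
  · simp only [rpow0, hx.ne', hy.ne', if_false, Real.rpow_eq_pow]
    calc x = x ^ (1 - α) * x ^ α := by rw [← Real.rpow_add hx]; simp
      _ ≤ x ^ (1 - α) * (c * y) ^ α := by gcongr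
      _ = c ^ α * (x ^ (1 - α) * y ^ α) := by rw [Real.mul_rpow hc.le hy.le]; ring

theorem mul_le_rpow_mul_rpow0_of_le {x y c α : ℝ} (hy : 0 ≤ y) (hc : 0 < c) (hα : α ≤ 1)
    (h : c * y ≤ x) : c * y ≤ c ^ α * (rpow0 x (1 - α) * rpow0 y α) := by
  rcases hy.eq_or_lt with rfl | hy
  · simp [rpow0]
  · have hcy : 0 < c * y := mul_pos hc hy
    have hx : 0 < x := hcy.trans_le h
    simp only [rpow0, hx.ne', hy.ne', if_false, Real.rpow_eq_pow]
    calc c * y = (c * y) ^ (1 - α) * (c * y) ^ α := by rw [← Real.rpow_add hcy]; simp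
      _ ≤ x ^ (1 - α) * (c * y) ^ α := by
        gcongr
      _ = c ^ α * (x ^ (1 - α) * y ^ α) := by rw [Real.mul_rpow hc.le hy.le]; ring

theorem rpow0_nonneg {x : ℝ} (hx : 0 ≤ x) (r : ℝ) : 0 ≤ rpow0 x r := by
  unfold rpow0
  split_ifs
  exacts [le_rfl, Real.rpow_nonneg hx r]

theorem Matrix.IsHermitian.trace_re_nonneg_of_mul_self {n : Type*} [Fintype n]
    {P : Matrix n n ℂ} (hP : P.IsHermitian) (hPP : P * P = P) : 0 ≤ P.trace.re := by
  have h := (Matrix.posSemidef_conjTranspose_mul_self P).trace_nonneg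
  rw [hP.eq, hPP] at h
  exact (Complex.le_def.1 h).1

/-- The trace of a real linear combination of matrices. -/
theorem Matrix.trace_re_sum_smul {n I : Type*} [Fintype n] (s : Finset I)
    (P : I → Matrix n n ℂ) (a : I → ℝ) :
    (∑ i ∈ s, (a i : ℂ) • P i).trace.re = ∑ i ∈ s, a i * (P i).trace.re := by
  simp [Matrix.trace_sum, Matrix.trace_smul]

/-- A partial sum of orthogonal idempotents acts on a linear combination by restricting it. -/
theorem Matrix.sum_mul_sum_smul_of_orthogonal {n I : Type*} [Fintype n] [Fintype I]
    {P : I → Matrix n n ℂ} (hIdem : ∀ i, P i * P i = P i)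
    (hOrth : ∀ i j, i ≠ j → P i * P j = 0) (s : Finset I) (a : I → ℂ) :
    (∑ i ∈ s, P i) * ∑ i, a i • P i = ∑ i ∈ s, a i • P i := by
  rw [Finset.sum_mul]
  refine Finset.sum_congr rfl fun i _ => ?_
  rw [Finset.mul_sum, Finset.sum_eq_single i]
  · rw [Matrix.mul_smul, hIdem]
  · intro j _ hj
    rw [Matrix.mul_smul, hOrth i j hj.symm, smul_zero]
  · simp

open Classical in
/-- STATEMENT 11: commuting core of the projector lemma. For commuting nonnegative
combinations `X = ∑ x_i P_i`, `Y = ∑ y_i P_i` of an orthogonal resolution of identity,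
with `Π = ∑_{x_i ≥ c y_i} P_i`, both `Tr[(I − Π)X]` and `c · Tr[Π Y]` are bounded by
`c^α · Tr[X^{1−α} Y^α]`. -/
theorem commuting_projector_lemma
    {n : Type*} [Fintype n] [DecidableEq n] {I : Type*} [Fintype I]
    (P : I → Matrix n n ℂ)
    (hHerm : ∀ i, (P i).IsHermitian)
    (hIdem : ∀ i, P i * P i = P i)
    (hOrth : ∀ i j, i ≠ j → P i * P j = 0)
    (hSum : ∑ i : I, P i = 1)
    (x y : I → ℝ) (hx : ∀ i, 0 ≤ x i) (hy : ∀ i, 0 ≤ y i)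
    (c α : ℝ) (hc : 0 < c) (hα : α ∈ Set.Ioc (0 : ℝ) 1)
    (X Y Pr Z : Matrix n n ℂ)
    (hX : X = ∑ i : I, ((x i : ℝ) : ℂ) • P i)
    (hY : Y = ∑ i : I, ((y i : ℝ) : ℂ) • P i)
    (hPr : Pr = ∑ i ∈ Finset.univ.filter (fun i : I => c * y i ≤ x i), P i)
    (hZ : Z = ∑ i : I, ((rpow0 (x i) (1 - α) * rpow0 (y i) α : ℝ) : ℂ) • P i) :
    ((1 - Pr) * X).trace.re ≤ c ^ α * Z.trace.re ∧
      c * (Pr * Y).trace.re ≤ c ^ α * Z.trace.re := by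
  have ht i := (hHerm i).trace_re_nonneg_of_mul_self (hIdem i)
  have hcompl : 1 - Pr = ∑ i ∈ Finset.univ.filter (fun i : I => ¬ c * y i ≤ x i), P i := by
    rw [hPr, ← hSum, sub_eq_iff_eq_add', Finset.sum_filter_add_sum_filter_not]
  have hbound (s : Finset I) (b : I → ℝ)
      (hb : ∀ i ∈ s, b i ≤ c ^ α * (rpow0 (x i) (1 - α) * rpow0 (y i) α)) :
      ∑ i ∈ s, b i * (P i).trace.re ≤ c ^ α * Z.trace.re := by
    rw [hZ, Matrix.trace_re_sum_smul, Finset.mul_sum]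
    simp only [← mul_assoc] at hb ⊢
    refine (Finset.sum_le_sum fun i hi =>
      mul_le_mul_of_nonneg_right (hb i hi) (ht i)).trans
        (Finset.sum_le_sum_of_subset_of_nonneg (Finset.subset_univ s) fun i _ _ => ?_)
    exact mul_nonneg (mul_nonneg (mul_nonneg (Real.rpow_nonneg hc.le α)
      (rpow0_nonneg (hx i) _)) (rpow0_nonneg (hy i) _)) (ht i)
  constructor
  · rw [hcompl, hX, Matrix.sum_mul_sum_smul_of_orthogonal hIdem hOrth, Matrix.trace_re_sum_smul]
    refine hbound _ _ fun i hi => ?_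
    exact le_rpow_mul_rpow0_of_lt (hx i) hc hα.1.le (not_le.1 (Finset.mem_filter.1 hi).2)
  · rw [hPr, hY, Matrix.sum_mul_sum_smul_of_orthogonal hIdem hOrth, Matrix.trace_re_sum_smul,
      Finset.mul_sum]
    simp only [← mul_assoc c]
    refine hbound _ _ fun i hi => ?_
    exact mul_le_rpow_mul_rpow0_of_le (hy i) hc hα.2 (Finset.mem_filter.1 hi).2
end

section
/- Let ρ and σ be density matrices on ℂ^d and let Δ be a Hermitian d×d matrix with 0 ≤ Δ ≤ I. Then |√(Tr[Δσ]) − √(Tr[Δρ])| ≤ P(σ, ρ), where Tr[Δσ] and Tr[Δρ] are real numbers in [0,1] and P is the purified distance. -/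
open Matrix BigOperators
open scoped ComplexOrder

namespace PurifiedDistBound

variable {n : Type*} [Fintype n] [DecidableEq n]

lemma rpow0_mul_rpow0 {x : ℝ} (hx : 0 ≤ x) (r s : ℝ) :
    rpow0 x r * rpow0 x s = rpow0 x (r + s) := by
  unfold rpow0
  split_ifs with h
  · simp
  · exact (Real.rpow_add (lt_of_le_of_ne hx (Ne.symm h)) r s).symm

lemma rpow0_one (x : ℝ) : rpow0 x 1 = x := by
  unfold rpow0
  split_ifs with h
  · exact h.symm
  · exact Real.rpow_one x

lemma rpow0_nonneg {x : ℝ} (hx : 0 ≤ x) (r : ℝ) : 0 ≤ rpow0 x r := by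
  unfold rpow0
  split_ifs with h
  · exact le_rfl
  · exact Real.rpow_nonneg hx r

lemma matPow_isHermitian (M : Matrix n n ℂ) (r : ℝ) : (matPow M r).IsHermitian := by
  unfold matPow
  split_ifs with h
  · have hd : (diagonal (fun i => (rpow0 (h.eigenvalues i) r : ℂ))).IsHermitian := by
      refine isHermitian_diagonal_of_self_adjoint _ ?_
      ext i
      simp
    exact isHermitian_mul_mul_conjTranspose _ hd
  · exact isHermitian_zero

lemma matPow_mul_matPow {M : Matrix n n ℂ} (hM : M.PosSemidef) (r s : ℝ) :
    matPow M r * matPow M s = matPow M (r + s) := by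
  have h := hM.isHermitian
  have hU : star (h.eigenvectorUnitary : Matrix n n ℂ) *
      (h.eigenvectorUnitary : Matrix n n ℂ) = 1 :=
    Unitary.coe_star_mul_self _
  simp only [matPow, dif_pos h]
  set U := (h.eigenvectorUnitary : Matrix n n ℂ)
  have hD : diagonal (fun i => (rpow0 (h.eigenvalues i) r : ℂ)) *
      diagonal (fun i => (rpow0 (h.eigenvalues i) s : ℂ)) =
      diagonal (fun i => (rpow0 (h.eigenvalues i) (r + s) : ℂ)) := by
    rw [diagonal_mul_diagonal]
    congr 1
    ext i
    rw [← rpow0_mul_rpow0 (hM.eigenvalues_nonneg i)]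
    push_cast
    rfl
  rw [← hD]
  simp only [Matrix.mul_assoc]
  rw [← Matrix.mul_assoc (star U) U, hU, Matrix.one_mul]

lemma matPow_one {M : Matrix n n ℂ} (h : M.IsHermitian) : matPow M 1 = M := by
  conv_rhs => rw [h.spectral_theorem]
  simp only [matPow, dif_pos h, rpow0_one]
  rfl

lemma trace_matPow_nonneg {M : Matrix n n ℂ} (hM : M.PosSemidef) (r : ℝ) :
    0 ≤ (matPow M r).trace.re := by
  have h := hM.isHermitian
  have hU : star (h.eigenvectorUnitary : Matrix n n ℂ) *
      (h.eigenvectorUnitary : Matrix n n ℂ) = 1 :=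
    Unitary.coe_star_mul_self _
  simp only [matPow, dif_pos h]
  rw [trace_mul_comm, ← Matrix.mul_assoc, hU, Matrix.one_mul, trace_diagonal, Complex.re_sum]
  exact Finset.sum_nonneg fun i _ => rpow0_nonneg (hM.eigenvalues_nonneg i) r

lemma exists_conjTranspose_mul_self {M : Matrix n n ℂ} (hM : M.PosSemidef) :
    ∃ S : Matrix n n ℂ, Sᴴ * S = M := by
  refine ⟨matPow M (1 / 2), ?_⟩
  rw [(matPow_isHermitian M _).eq, matPow_mul_matPow hM, add_halves, matPow_one hM.isHermitian]

/-- The Cauchy–Schwarz inequality for the Hilbert–Schmidt inner product. -/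
lemma re_trace_conjTranspose_mul_le {ι : Type*} [Fintype ι] (X Y : Matrix ι ι ℂ) :
    (Xᴴ * Y).trace.re ≤ √((Xᴴ * X).trace.re) * √((Yᴴ * Y).trace.re) := by
  have hself (Z : Matrix ι ι ℂ) :
      (Zᴴ * Z).trace.re = ∑ p : ι × ι, ‖Z p.2 p.1‖ ^ 2 := by
    rw [Fintype.sum_prod_type]
    simp [Matrix.trace, Matrix.mul_apply, Complex.re_sum, ← Complex.normSq_eq_norm_sq,
      Complex.normSq_apply]
  rw [hself, hself]
  refine le_trans ?_ (Real.sum_mul_le_sqrt_mul_sqrt _ _ _)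
  rw [Fintype.sum_prod_type]
  simp only [Matrix.trace, Matrix.mul_apply, Complex.re_sum, Matrix.diag_apply,
    Matrix.conjTranspose_apply]
  refine Finset.sum_le_sum fun i _ => Finset.sum_le_sum fun j _ => ?_
  refine (Complex.re_le_norm _).trans ?_
  simp

/-- Compressing by a partial isometry does not increase the trace of a positive matrix. -/
lemma re_trace_conjTranspose_mul_mul_le {X W : Matrix n n ℂ} (hX : X.PosSemidef)
    (hW : Wᴴ * W * (Wᴴ * W) = Wᴴ * W) : (Wᴴ * X * W).trace.re ≤ X.trace.re := by
  have hWP : W * (Wᴴ * W) = W := by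
    rw [← sub_eq_zero, ← conjTranspose_mul_self_eq_zero]
    simp only [conjTranspose_sub, conjTranspose_mul, conjTranspose_conjTranspose, Matrix.sub_mul,
      Matrix.mul_sub]
    simp only [← Matrix.mul_assoc] at hW ⊢
    simp [hW]
  have hQ : (1 - W * Wᴴ) * (1 - W * Wᴴ) = 1 - W * Wᴴ := by
    have : W * Wᴴ * (W * Wᴴ) = W * Wᴴ := by
      rw [← Matrix.mul_assoc, Matrix.mul_assoc W, hWP]
    rw [Matrix.sub_mul, Matrix.mul_sub, Matrix.mul_sub, this]
    simp
  have hpos := (hX.mul_mul_conjTranspose_same (1 - W * Wᴴ)).trace_nonneg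
  have hQh : (1 - W * Wᴴ)ᴴ = 1 - W * Wᴴ := by simp
  rw [hQh, trace_mul_comm, ← Matrix.mul_assoc, hQ, Matrix.sub_mul, Matrix.one_mul, trace_sub,
    Matrix.mul_assoc, trace_mul_comm W] at hpos
  have := (Complex.le_def.mp hpos).1
  simp only [Complex.zero_re, Complex.sub_re] at this
  linarith

lemma re_trace_mul_nonneg {A B : Matrix n n ℂ} (hA : A.PosSemidef) (hB : B.PosSemidef) :
    0 ≤ (A * B).trace.re := by
  obtain ⟨S, rfl⟩ := exists_conjTranspose_mul_self hB
  rw [← Matrix.mul_assoc, trace_mul_comm, ← Matrix.mul_assoc]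
  exact (Complex.le_def.mp (hA.mul_mul_conjTranspose_same S).trace_nonneg).1

/-- The part of the overlap of two positive matrices seen by an effect `Δ` is bounded by the
geometric mean of the weights of `Δ`. -/
lemma re_trace_partialIsometry_le {S A W Δ : Matrix n n ℂ} (hΔ : Δ.PosSemidef)
    (hW : Wᴴ * W * (Wᴴ * W) = Wᴴ * W) :
    (Wᴴ * S * Δ * A).trace.re ≤
      √((Δ * (Sᴴ * S)).trace.re) * √((Δ * (A * Aᴴ)).trace.re) := by
  obtain ⟨B, rfl⟩ := exists_conjTranspose_mul_self hΔ
  have key := re_trace_conjTranspose_mul_le (B * Sᴴ * W) (B * A)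
  have hS := re_trace_conjTranspose_mul_mul_le (hΔ.mul_mul_conjTranspose_same S) hW
  have h₁ : (B * Sᴴ * W)ᴴ * (B * A) = Wᴴ * S * (Bᴴ * B) * A := by
    simp [conjTranspose_mul, Matrix.mul_assoc]
  have h₂ : (B * Sᴴ * W)ᴴ * (B * Sᴴ * W) = Wᴴ * (S * (Bᴴ * B) * Sᴴ) * W := by
    simp [conjTranspose_mul, Matrix.mul_assoc]
  have h₃ : ((B * A)ᴴ * (B * A)).trace = (Bᴴ * B * (A * Aᴴ)).trace := by
    rw [← Matrix.mul_assoc _ A, trace_mul_comm _ Aᴴ]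
    simp [conjTranspose_mul, Matrix.mul_assoc]
  have h₄ : (S * (Bᴴ * B) * Sᴴ).trace = (Bᴴ * B * (Sᴴ * S)).trace := by
    rw [Matrix.mul_assoc, trace_mul_comm]
    simp [Matrix.mul_assoc]
  rw [h₁, h₂, h₃] at key
  rw [h₄] at hS
  exact key.trans (mul_le_mul_of_nonneg_right (Real.sqrt_le_sqrt hS) (Real.sqrt_nonneg _))

lemma posSemidef_sandwich {ρ σ : Matrix n n ℂ} (hσ : σ.PosSemidef) :
    (matPow ρ (1 / 2) * σ * matPow ρ (1 / 2)).PosSemidef := by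
  simpa only [(matPow_isHermitian ρ (1 / 2)).eq] using
    hσ.mul_mul_conjTranspose_same (matPow ρ (1 / 2))

lemma fidelity_nonneg {ρ σ : Matrix n n ℂ} (hσ : σ.PosSemidef) : 0 ≤ fidelity σ ρ :=
  trace_matPow_nonneg (posSemidef_sandwich hσ) _

/-- The fidelity is at most the Bhattacharyya overlap of the outcomes of a two-outcome
measurement. -/
lemma fidelity_le_overlap {ρ σ Δ : Matrix n n ℂ} (hρ : ρ.PosSemidef) (hσ : σ.PosSemidef)
    (hΔ : Δ.PosSemidef) (hΔ1 : (1 - Δ).PosSemidef) :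
    fidelity σ ρ ≤ √((Δ * σ).trace.re) * √((Δ * ρ).trace.re) +
      √(((1 - Δ) * σ).trace.re) * √(((1 - Δ) * ρ).trace.re) := by
  obtain ⟨S, hS⟩ := exists_conjTranspose_mul_self hσ
  have hM := posSemidef_sandwich (ρ := ρ) hσ
  have hA := matPow_isHermitian ρ (1 / 2)
  have hAA : matPow ρ (1 / 2) * (matPow ρ (1 / 2))ᴴ = ρ := by
    rw [hA.eq, matPow_mul_matPow hρ, add_halves, matPow_one hρ.isHermitian]
  unfold fidelity
  set A := matPow ρ (1 / 2)
  set M := A * σ * A with hMdef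
  have hK := matPow_isHermitian M (-(1 / 2))
  have hKM : matPow M (-(1 / 2)) * M = matPow M (1 / 2) := by
    calc matPow M (-(1 / 2)) * M = matPow M (-(1 / 2)) * matPow M 1 := by
          rw [matPow_one hM.isHermitian]
      _ = matPow M (1 / 2) := by
          rw [matPow_mul_matPow hM]
          norm_num
  set K := matPow M (-(1 / 2)) with hKdef
  set W := S * A * K with hWdef
  have hWS : Wᴴ * S * A = matPow M (1 / 2) := by
    rw [← hKM, hWdef, hMdef, ← hS]
    simp only [conjTranspose_mul, hA.eq, hK.eq, Matrix.mul_assoc]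
  have hWW : Wᴴ * W = matPow M 0 := by
    rw [hWdef, ← Matrix.mul_assoc, ← Matrix.mul_assoc, ← hWdef, hWS, hKdef, matPow_mul_matPow hM]
    norm_num
  have hW : Wᴴ * W * (Wᴴ * W) = Wᴴ * W := by
    rw [hWW, matPow_mul_matPow hM, add_zero]
  have h₁ := re_trace_partialIsometry_le (S := S) (A := A) hΔ hW
  have h₂ := re_trace_partialIsometry_le (S := S) (A := A) hΔ1 hW
  rw [hS, hAA] at h₁ h₂
  have hsplit : matPow M (1 / 2) = Wᴴ * S * Δ * A + Wᴴ * S * (1 - Δ) * A := by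
    rw [← hWS, ← Matrix.add_mul, ← Matrix.mul_add, add_sub_cancel, Matrix.mul_one]
  rw [hsplit, trace_add, Complex.add_re]
  exact add_le_add h₁ h₂

/-- The chordal difference of sines is bounded by the sine of the difference of the angles. -/
lemma sq_sub_le_one_sub_sq {a b c d : ℝ} (ha : 0 ≤ a) (hb : 0 ≤ b) (hc : 0 ≤ c) (hd : 0 ≤ d)
    (hac : a ^ 2 + c ^ 2 = 1) (hbd : b ^ 2 + d ^ 2 = 1) :
    (a - b) ^ 2 ≤ 1 - (a * b + c * d) ^ 2 := by
  wlog hab : b ≤ a generalizing a b c d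
  · have := this hb ha hd hc hbd hac (le_of_not_ge hab)
    linarith [show (b - a) ^ 2 = (a - b) ^ 2 by ring,
      show b * a + d * c = a * b + c * d by ring]
  have hcd : c ≤ d := by nlinarith
  have hrw : 1 - (a * b + c * d) ^ 2 = (a * d - b * c) ^ 2 := by
    linear_combination (-(b ^ 2 + d ^ 2)) * hac - hbd
  rw [hrw]
  refine pow_le_pow_left₀ (sub_nonneg.mpr hab) ?_ 2
  have h : 0 ≤ a * b * (a * (1 + d) - b * (1 + c)) :=
    mul_nonneg (mul_nonneg ha hb) (sub_nonneg.mpr (by gcongr))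
  have heq : a * b * (a * (1 + d) - b * (1 + c)) =
      (b * (1 - c) - a * (1 - d)) * ((1 + c) * (1 + d)) := by
    linear_combination (b * (1 + d)) * hac - (a * (1 + c)) * hbd
  rw [heq] at h
  have := nonneg_of_mul_nonneg_left h (by positivity)
  linarith

end PurifiedDistBound

/-- STATEMENT 16: for density matrices `ρ, σ` and `0 ≤ Δ ≤ I`,
`|√(Tr[Δσ]) − √(Tr[Δρ])| ≤ P(σ, ρ)` ([Anshu–Jain–Warsi, Fact 7]). -/
theorem sqrt_trace_diff_le_purifiedDist
    {n : Type*} [Fintype n] [DecidableEq n]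
    (ρ σ Δ : Matrix n n ℂ) (hρ : IsDensityMatrix ρ) (hσ : IsDensityMatrix σ)
    (hΔ : Δ.PosSemidef) (hΔ1 : ((1 : Matrix n n ℂ) - Δ).PosSemidef) :
    |Real.sqrt ((Δ * σ).trace.re) - Real.sqrt ((Δ * ρ).trace.re)| ≤
      purifiedDist σ ρ := by
  have hcompl {τ : Matrix n n ℂ} (hτ : IsDensityMatrix τ) :
      √((Δ * τ).trace.re) ^ 2 + √(((1 - Δ) * τ).trace.re) ^ 2 = 1 := by
    rw [Real.sq_sqrt (PurifiedDistBound.re_trace_mul_nonneg hΔ hτ.1),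
      Real.sq_sqrt (PurifiedDistBound.re_trace_mul_nonneg hΔ1 hτ.1), ← Complex.add_re,
      ← trace_add, ← Matrix.add_mul, add_sub_cancel, Matrix.one_mul, hτ.2, Complex.one_re]
  refine Real.abs_le_sqrt ?_
  refine (PurifiedDistBound.sq_sub_le_one_sub_sq (Real.sqrt_nonneg _) (Real.sqrt_nonneg _)
    (Real.sqrt_nonneg _) (Real.sqrt_nonneg _) (hcompl hσ) (hcompl hρ)).trans ?_
  exact sub_le_sub_left (pow_le_pow_left₀ (PurifiedDistBound.fidelity_nonneg hσ.1)
    (PurifiedDistBound.fidelity_le_overlap hρ.1 hσ.1 hΔ hΔ1) 2) 1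
end
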